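/- Let n ≥ 3 and let H be the cycle graph C_n on n vertices. For every vertex i of H let G_i be a connected finite simple graph with property (P), with an arbitrarily chosen bail vertex b_i in G_i. Then the threaded union T_H[𝒢] of the family 𝒢 = {(G_i, b_i)} over the cycle H has property (P), for every choice of bail vertices. -/

import Mathlib

open Matrix SimpleGraph

/-- A finite simple graph `G` has property (P) if there is a real symmetric matrix `A`
whose off-diagonal support is exactly the edge set of `G`, with `det A ≠ 0`, and such that
every principal submatrix obtained by deleting one row/column is singular. -/
def HasPropertyP {V : Type*} [Finite V] (G : SimpleGraph V) : Prop :=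
  letI : Fintype V := Fintype.ofFinite V
  letI : DecidableEq V := Classical.decEq V
  ∃ A : Matrix V V ℝ, A.IsSymm ∧
    (∀ u v : V, u ≠ v → (A u v ≠ 0 ↔ G.Adj u v)) ∧
    A.det ≠ 0 ∧
    ∀ v : V,
      (A.submatrix (fun x : {x : V // x ≠ v} => (x : V))
        (fun x : {x : V // x ≠ v} => (x : V))).det = 0


/-- The threaded union of the family of graphs `G i` (with bail vertices `b i`) over the
graph `H`: vertices `⟨i, x⟩` and `⟨j, y⟩` are adjacent iff either `i = j` and `x, y` are
adjacent in `G i`, or `i ≠ j`, `i` and `j` are adjacent in `H`, `x = b i` and `y = b j`. -/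
def threadedUnion {ι : Type*} (H : SimpleGraph ι) {V : ι → Type*}
    (G : ∀ i, SimpleGraph (V i)) (b : ∀ i, V i) : SimpleGraph (Σ i, V i) :=
  SimpleGraph.fromRel fun x y =>
    (∃ (i : ι) (u v : V i), (G i).Adj u v ∧ x = ⟨i, u⟩ ∧ y = ⟨i, v⟩) ∨
    (x.1 ≠ y.1 ∧ H.Adj x.1 y.1 ∧ x.2 = b x.1 ∧ y.2 = b y.1)

/-- The cycle graph on `ZMod n`: `i` and `j` are adjacent iff `j = i + 1` or `i = j + 1`. -/
def cycleG (n : ℕ) : SimpleGraph (ZMod n) :=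
  SimpleGraph.fromRel fun i j => j = i + 1

open Classical in
theorem det_minor_eq_adjugate {V : Type*} [Fintype V] (A : Matrix V V ℝ) (v : V) :
    (A.submatrix (fun x : {x : V // x ≠ v} => (x : V))
        (fun x : {x : V // x ≠ v} => (x : V))).det = A.adjugate v v := by
  rw [adjugate_apply, twoBlockTriangular_det _ (fun x => x ≠ v)]
  · have h1 : (toSquareBlockProp (A.updateRow v (Pi.single v 1)) fun x => x ≠ v) =
        A.submatrix (fun x : {x : V // x ≠ v} => (x : V))
          (fun x : {x : V // x ≠ v} => (x : V)) := by
      ext x y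
      simp [toSquareBlockProp, updateRow_ne x.2]
    have h2 : (toSquareBlockProp (A.updateRow v (Pi.single v 1)) fun x => ¬ x ≠ v) = 1 := by
      ext ⟨x, hx⟩ ⟨y, hy⟩
      have hx' : x = v := not_not.mp hx
      have hy' : y = v := not_not.mp hy
      subst hx'
      subst hy'
      simp [toSquareBlockProp]
    rw [h1, h2, det_one, mul_one]
  · intro x hx y hy
    have hx' : x = v := not_not.mp hx
    subst hx'
    simp [hy]

open Classical in
theorem hasPropertyP_iff {V : Type*} [Finite V] [Fintype V] (G : SimpleGraph V) :
    HasPropertyP G ↔ ∃ A N : Matrix V V ℝ, A.IsSymm ∧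
      (∀ u v : V, u ≠ v → (A u v ≠ 0 ↔ G.Adj u v)) ∧ A * N = 1 ∧ ∀ v, N v v = 0 := by
  have key : HasPropertyP G ↔ ∃ A : Matrix V V ℝ, A.IsSymm ∧
    (∀ u v : V, u ≠ v → (A u v ≠ 0 ↔ G.Adj u v)) ∧
    A.det ≠ 0 ∧ ∀ v : V, A.adjugate v v = 0 := by
    simp only [← det_minor_eq_adjugate]
    unfold HasPropertyP
    refine exists_congr fun A => and_congr_right fun _ => and_congr_right fun _ =>
      and_congr ?_ (forall_congr' fun v => ?_)
    · exact Iff.of_eq (by congr!)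
    · exact Iff.of_eq (by congr!)
  rw [key]
  constructor
  · rintro ⟨A, hs, hp, hd, ha⟩
    refine ⟨A, A⁻¹, hs, hp, mul_nonsing_inv _ (isUnit_iff_ne_zero.mpr hd), fun v => ?_⟩
    simp [inv_def, ha]
  · rintro ⟨A, N, hs, hp, hm, hN⟩
    refine ⟨A, hs, hp, ?_, fun v => ?_⟩
    · intro h
      have := congrArg det hm
      simp [h] at this
    · have : A.adjugate = A.det • N := by
        calc A.adjugate = A.adjugate * (A * N) := by rw [hm, mul_one]
          _ = A.det • N := by rw [← mul_assoc, adjugate_mul, smul_mul, one_mul]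
      rw [this]
      simp [hN]

open Classical in
/-- The perturbation matrix joining the bail vertices. -/
noncomputable def bailMat {ι : Type*} (H : SimpleGraph ι) {V : ι → Type*} (b : ∀ i, V i) :
    Matrix (Σ i, V i) (Σ i, V i) ℝ :=
  fun p q => if H.Adj p.1 q.1 ∧ p.2 = b p.1 ∧ q.2 = b q.1 then 1 else 0

theorem threadedUnion_hasPropertyP {ι : Type*} [Finite ι] (H : SimpleGraph ι)
    {V : ι → Type*} [∀ i, Finite (V i)] (G : ∀ i, SimpleGraph (V i))
    (hGP : ∀ i, HasPropertyP (G i)) (b : ∀ i, V i) :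
    HasPropertyP (threadedUnion H G b) := by
  classical
  letI : Fintype ι := Fintype.ofFinite ι
  letI : ∀ i, Fintype (V i) := fun i => Fintype.ofFinite (V i)
  simp only [hasPropertyP_iff] at hGP
  choose A N hs hp hm hN using hGP
  rw [hasPropertyP_iff]
  set D := blockDiagonal' A with hD
  set B := blockDiagonal' N with hB
  set E := bailMat H b with hE
  have hDB : D * B = 1 := by
    rw [hD, hB, ← blockDiagonal'_mul]
    simp only [hm]
    exact blockDiagonal'_one
  have hEBE : E * B * E = 0 := by
    ext p q
    rw [mul_apply]
    refine Finset.sum_eq_zero fun s _ => ?_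
    rw [mul_apply, Finset.sum_mul]
    refine Finset.sum_eq_zero fun r _ => ?_
    obtain ⟨i, x⟩ := s
    obtain ⟨j, y⟩ := r
    by_cases h : j = i
    · subst h
      by_cases hx : x = b j
      · by_cases hy : y = b j
        · subst hx hy
          simp [hB, hN]
        · simp [hE, bailMat, hy]
      · simp [hE, bailMat, hx]
    · simp [hB, blockDiagonal'_apply_ne _ _ _ h]
  have hBEB : ∀ v, (B * E * B) v v = 0 := by
    rintro ⟨k, z⟩
    rw [mul_apply]
    refine Finset.sum_eq_zero fun s _ => ?_
    rw [mul_apply, Finset.sum_mul]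
    refine Finset.sum_eq_zero fun r _ => ?_
    obtain ⟨i, x⟩ := s
    obtain ⟨j, y⟩ := r
    by_cases h : k = j
    · by_cases h' : i = k
      · subst h' h
        simp [hE, bailMat]
      · simp [hB, blockDiagonal'_apply_ne _ _ _ h']
    · simp [hB, blockDiagonal'_apply_ne _ _ _ h]
  refine ⟨D + E, B - B * E * B, ?_, ?_, ?_, ?_⟩
  · refine IsSymm.add ?_ ?_
    · rw [IsSymm, hD, blockDiagonal'_transpose]
      congr 1
      funext i
      exact hs i
    · ext p q
      simp only [transpose_apply, hE, bailMat, H.adj_comm q.1 p.1]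
      congr 1
      simp only [and_comm]
  · rintro ⟨i, x⟩ ⟨j, y⟩ hne
    by_cases h : i = j
    · subst h
      have hxy : x ≠ y := fun h => hne (by rw [h])
      have := hp i x y hxy
      simp only [Matrix.add_apply, hD, hE, blockDiagonal'_apply_eq, bailMat, H.irrefl, false_and,
        if_false, add_zero, this, threadedUnion, fromRel_adj]
      constructor
      · intro h
        exact ⟨hne, Or.inl (Or.inl ⟨i, x, y, h, rfl, rfl⟩)⟩
      · rintro ⟨-, (⟨i', u, v, h, h1, h2⟩ | ⟨h, -⟩) | (⟨i', u, v, h, h1, h2⟩ | ⟨h, -⟩)⟩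
        · cases h1
          cases h2
          exact h
        · exact absurd rfl h
        · cases h1
          cases h2
          exact h.symm
        · exact absurd rfl h
    · simp only [Matrix.add_apply, hD, hE, blockDiagonal'_apply_ne _ _ _ h, bailMat, zero_add,
        threadedUnion, fromRel_adj]
      constructor
      · intro hh
        refine ⟨hne, Or.inl (Or.inr ⟨h, ?_⟩)⟩
        by_contra hc
        exact hh (if_neg hc)
      · rintro ⟨-, (⟨i', u, v, -, h1, h2⟩ | ⟨-, h1, h2, h3⟩) |
          (⟨i', u, v, -, h1, h2⟩ | ⟨-, h1, h2, h3⟩)⟩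
        · cases h1
          cases h2
          exact absurd rfl h
        · rw [if_pos ⟨h1, h2, h3⟩]
          exact one_ne_zero
        · cases h1
          cases h2
          exact absurd rfl h
        · rw [if_pos ⟨h1.symm, h3, h2⟩]
          exact one_ne_zero
  · calc (D + E) * (B - B * E * B)
        = D * B + E * B - (D * B) * (E * B) - (E * B * E) * B := by noncomm_ring
      _ = 1 := by rw [hDB, hEBE]; simp
      _ = _ := by congr!
  · rintro ⟨i, x⟩
    rw [Matrix.sub_apply, hBEB, hB, blockDiagonal'_apply_eq, hN, sub_zero]

/-- If `H` is the cycle on `n ≥ 3` vertices and each `G i` is a connected graph with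
property (P), then the threaded union of the `G i` over `H` has property (P), for every
choice of bail vertices. -/
theorem stmt_13 (n : ℕ) (hn : 3 ≤ n) {V : ZMod n → Type*} [∀ i, Finite (V i)]
    (G : ∀ i, SimpleGraph (V i))
    (hGconn : ∀ i, (G i).Connected) (hGP : ∀ i, HasPropertyP (G i))
    (b : ∀ i, V i) :
    haveI : NeZero n := ⟨by omega⟩
    HasPropertyP (threadedUnion (cycleG n) G b) := by
  haveI : NeZero n := ⟨by omega⟩
  exact threadedUnion_hasPropertyP (cycleG n) G hGP b
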